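/- Let i, i' ∈ ℐ and let r_{h,k}, r'_{h,k} be defined from i, i' respectively. (1) Suppose for some l, i'_k=i_k for all k∉{l,l+1,l+2}, and (i_l,i_{l+1},i_{l+2})=(i,j,i), (i'_l,i'_{l+1},i'_{l+2})=(j,i,j) where a_{ij}=-1. Then for every h∈I: r_{h,k}=r'_{h,k} for k∉{l,l+1,l+2}, r_{h,l}=r'_{h,l+2}, r_{h,l+2}=r'_{h,l}, and r_{h,l+1}=r'_{h,l+1}=r_{h,l}+r_{h,l+2}. (2) Suppose for some l, i'_k=i_k for all k∉{l,l+1}, and (i_l,i_{l+1})=(i,j), (i'_l,i'_{l+1})=(j,i) where a_{ij}=0. Then for every h∈I: r_{h,k}=r'_{h,k} for k∉{l,l+1}, r_{h,l}=r'_{h,l+1}, and r_{h,l+1}=r'_{h,l}. -/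

import Mathlib

open scoped BigOperators

namespace Lusztig

variable {I : Type*} [Fintype I] [DecidableEq I]

/-- A simply laced Cartan matrix: symmetric, positive definite, integer entries,
`2` on the diagonal and `0` or `-1` off the diagonal. -/
structure IsSimplyLacedCartan (A : Matrix I I ℤ) : Prop where
  symm : ∀ i j, A i j = A j i
  posDef : ∀ x : I → ℤ, x ≠ 0 → 0 < ∑ i, ∑ j, x i * A i j * x j
  diag : ∀ i, A i i = 2
  offDiag : ∀ i j, i ≠ j → A i j = 0 ∨ A i j = -1

/-- The simple reflection `s_i` acting on `ℤ[I] = I → ℤ`, `s_i(j') = j' - a_{ij} i'`. -/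
def sE (A : Matrix I I ℤ) (i : I) : Function.End (I → ℤ) :=
  fun x => x - (∑ j, A i j * x j) • Pi.single i 1

/-- The length of `w`: the least `n` such that `w` is a product of `n` simple
reflections (`∞` convention: `sInf ∅ = 0`). -/
noncomputable def len (A : Matrix I I ℤ) (w : Function.End (I → ℤ)) : ℕ :=
  sInf {n | ∃ l : List I, l.length = n ∧ (l.map (sE A)).prod = w}

/-- `w₀` is the longest element of `W = ⟨s_i⟩` and `ν = |w₀|`. -/
structure IsLongest (A : Matrix I I ℤ) (w₀ : Function.End (I → ℤ)) (ν : ℕ) : Prop where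
  mem : ∃ l : List I, (l.map (sE A)).prod = w₀
  len_eq : len A w₀ = ν
  longest : ∀ w : Function.End (I → ℤ),
    (∃ l : List I, (l.map (sE A)).prod = w) → len A w ≤ ν

/-- `ℐ`: the set of sequences `(i_1, …, i_ν)` with `s_{i_1} ⋯ s_{i_ν} = w₀`. -/
def RedWord (A : Matrix I I ℤ) (w₀ : Function.End (I → ℤ)) (ν : ℕ) :
    Set (Fin ν → I) :=
  {f | ((List.ofFn f).map (sE A)).prod = w₀}

/-- The coefficient `r_{h,k}` defined by
`s_{i_1} ⋯ s_{i_{k-1}} (i_k') = Σ_h r_{h,k} h'` (here `k` is `0`-indexed). -/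
def rCoef (A : Matrix I I ℤ) {ν : ℕ} (f : Fin ν → I) (h : I) (k : Fin ν) : ℤ :=
  ((List.ofFn fun m : Fin (k : ℕ) => sE A (f (Fin.castLE k.2.le m))).prod :
    Function.End (I → ℤ)) (Pi.single (f k) 1) h

/-- `‖i,a‖_h = Π_k a_k^{r_{h,k}}`. -/
def normAt (A : Matrix I I ℤ) {ν : ℕ} {K : Type*} [CommGroup K]
    (f : Fin ν → I) (a : Fin ν → K) (h : I) : K :=
  ∏ k : Fin ν, a k ^ rCoef A f h k

section Semifield

variable {K : Type*} [CommGroup K] [AddCommSemigroup K]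

/-- Adjacency of two pairs in `ℐ × K^ν`, for a semifield `K` (written
multiplicatively, with addition `+`). -/
def Adjacent (A : Matrix I I ℤ) (w₀ : Function.End (I → ℤ)) (ν : ℕ)
    (p q : (Fin ν → I) × (Fin ν → K)) : Prop :=
  p.1 ∈ RedWord A w₀ ν ∧ q.1 ∈ RedWord A w₀ ν ∧
  ((∃ (l : ℕ) (h0 : l < ν) (h1 : l + 1 < ν) (h2 : l + 2 < ν),
      A (p.1 ⟨l, h0⟩) (p.1 ⟨l + 1, h1⟩) = -1 ∧
      p.1 ⟨l + 2, h2⟩ = p.1 ⟨l, h0⟩ ∧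
      q.1 ⟨l, h0⟩ = p.1 ⟨l + 1, h1⟩ ∧ q.1 ⟨l + 1, h1⟩ = p.1 ⟨l, h0⟩ ∧
      q.1 ⟨l + 2, h2⟩ = p.1 ⟨l + 1, h1⟩ ∧
      (∀ k : Fin ν, (k : ℕ) ≠ l → (k : ℕ) ≠ l + 1 → (k : ℕ) ≠ l + 2 →
        q.1 k = p.1 k ∧ q.2 k = p.2 k) ∧
      q.2 ⟨l, h0⟩ =
        p.2 ⟨l + 1, h1⟩ * p.2 ⟨l + 2, h2⟩ * (p.2 ⟨l, h0⟩ + p.2 ⟨l + 2, h2⟩)⁻¹ ∧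
      q.2 ⟨l + 1, h1⟩ = p.2 ⟨l, h0⟩ + p.2 ⟨l + 2, h2⟩ ∧
      q.2 ⟨l + 2, h2⟩ =
        p.2 ⟨l, h0⟩ * p.2 ⟨l + 1, h1⟩ * (p.2 ⟨l, h0⟩ + p.2 ⟨l + 2, h2⟩)⁻¹) ∨
   (∃ (l : ℕ) (h0 : l < ν) (h1 : l + 1 < ν),
      A (p.1 ⟨l, h0⟩) (p.1 ⟨l + 1, h1⟩) = 0 ∧
      q.1 ⟨l, h0⟩ = p.1 ⟨l + 1, h1⟩ ∧ q.1 ⟨l + 1, h1⟩ = p.1 ⟨l, h0⟩ ∧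
      (∀ k : Fin ν, (k : ℕ) ≠ l → (k : ℕ) ≠ l + 1 →
        q.1 k = p.1 k ∧ q.2 k = p.2 k) ∧
      q.2 ⟨l, h0⟩ = p.2 ⟨l + 1, h1⟩ ∧ q.2 ⟨l + 1, h1⟩ = p.2 ⟨l, h0⟩))

end Semifield

/-- Adjacency of two pairs in `ℐ × ℤ^ν` for the tropical semifield `ℤ`
(sum = `min`, product = `+`). -/
def TAdjacent (A : Matrix I I ℤ) (w₀ : Function.End (I → ℤ)) (ν : ℕ)
    (p q : (Fin ν → I) × (Fin ν → ℤ)) : Prop :=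
  p.1 ∈ RedWord A w₀ ν ∧ q.1 ∈ RedWord A w₀ ν ∧
  ((∃ (l : ℕ) (h0 : l < ν) (h1 : l + 1 < ν) (h2 : l + 2 < ν),
      A (p.1 ⟨l, h0⟩) (p.1 ⟨l + 1, h1⟩) = -1 ∧
      p.1 ⟨l + 2, h2⟩ = p.1 ⟨l, h0⟩ ∧
      q.1 ⟨l, h0⟩ = p.1 ⟨l + 1, h1⟩ ∧ q.1 ⟨l + 1, h1⟩ = p.1 ⟨l, h0⟩ ∧
      q.1 ⟨l + 2, h2⟩ = p.1 ⟨l + 1, h1⟩ ∧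
      (∀ k : Fin ν, (k : ℕ) ≠ l → (k : ℕ) ≠ l + 1 → (k : ℕ) ≠ l + 2 →
        q.1 k = p.1 k ∧ q.2 k = p.2 k) ∧
      q.2 ⟨l, h0⟩ =
        p.2 ⟨l + 1, h1⟩ + p.2 ⟨l + 2, h2⟩ - min (p.2 ⟨l, h0⟩) (p.2 ⟨l + 2, h2⟩) ∧
      q.2 ⟨l + 1, h1⟩ = min (p.2 ⟨l, h0⟩) (p.2 ⟨l + 2, h2⟩) ∧
      q.2 ⟨l + 2, h2⟩ =
        p.2 ⟨l, h0⟩ + p.2 ⟨l + 1, h1⟩ - min (p.2 ⟨l, h0⟩) (p.2 ⟨l + 2, h2⟩)) ∨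
   (∃ (l : ℕ) (h0 : l < ν) (h1 : l + 1 < ν),
      A (p.1 ⟨l, h0⟩) (p.1 ⟨l + 1, h1⟩) = 0 ∧
      q.1 ⟨l, h0⟩ = p.1 ⟨l + 1, h1⟩ ∧ q.1 ⟨l + 1, h1⟩ = p.1 ⟨l, h0⟩ ∧
      (∀ k : Fin ν, (k : ℕ) ≠ l → (k : ℕ) ≠ l + 1 →
        q.1 k = p.1 k ∧ q.2 k = p.2 k) ∧
      q.2 ⟨l, h0⟩ = p.2 ⟨l + 1, h1⟩ ∧ q.2 ⟨l + 1, h1⟩ = p.2 ⟨l, h0⟩))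

section SimpleReflections

variable {A : Matrix I I ℤ}

theorem sE_apply (i : I) (x : I → ℤ) :
    sE A i x = x - (A.mulVec x i) • Pi.single i (1 : ℤ) := rfl

theorem sE_add (i : I) (x y : I → ℤ) : sE A i (x + y) = sE A i x + sE A i y := by
  simp only [sE_apply, Matrix.mulVec_add, Pi.add_apply]
  module

theorem mulVec_sE (i k : I) (x : I → ℤ) :
    A.mulVec (sE A i x) k = A.mulVec x k - A.mulVec x i * A k i := by
  rw [sE_apply, Matrix.mulVec_sub, Matrix.mulVec_smul]
  simp

theorem sE_single (i j : I) :
    sE A i (Pi.single j 1) = Pi.single j 1 - A i j • Pi.single i (1 : ℤ) := by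
  simp [sE_apply]

theorem sE_braid (hA : IsSimplyLacedCartan A) {i j : I} (hij : A i j = -1) :
    sE A i * sE A j * sE A i = sE A j * sE A i * sE A j := by
  have hji : A j i = -1 := by rw [hA.symm, hij]
  funext x
  change sE A i (sE A j (sE A i x)) = sE A j (sE A i (sE A j x))
  rw [sE_apply i (sE A j _), sE_apply j (sE A i (sE A j x))]
  simp only [mulVec_sE, hA.diag, hij, hji]
  rw [sE_apply j (sE A i x), sE_apply i (sE A j x)]
  simp only [mulVec_sE, hij, hji]
  simp only [sE_apply]
  module

theorem sE_comm (hA : IsSimplyLacedCartan A) {i j : I} (hij : A i j = 0) :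
    sE A i * sE A j = sE A j * sE A i := by
  have hji : A j i = 0 := by rw [hA.symm, hij]
  funext x
  change sE A i (sE A j x) = sE A j (sE A i x)
  rw [sE_apply i (sE A j x), sE_apply j (sE A i x)]
  simp only [mulVec_sE, hij, hji]
  simp only [sE_apply]
  module

theorem sE_sE_single_of_eq_neg_one (hA : IsSimplyLacedCartan A) {i j : I} (hij : A i j = -1) :
    sE A i (sE A j (Pi.single i 1)) = Pi.single j 1 := by
  have hji : A j i = -1 := by rw [hA.symm, hij]
  rw [sE_apply i, mulVec_sE, sE_single]
  simp [hij, hji, hA.diag]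

/-- The product of the first `n` simple reflections of the word `f`. -/
def prefixProd (A : Matrix I I ℤ) {ν : ℕ} (f : Fin ν → I) (n : ℕ) (hn : n ≤ ν) :
    Function.End (I → ℤ) :=
  (List.ofFn fun m : Fin n => sE A (f (Fin.castLE hn m))).prod

variable {ν : ℕ}

theorem rCoef_eq (f : Fin ν → I) (h : I) (k : ℕ) (hk : k < ν) :
    rCoef A f h ⟨k, hk⟩ = prefixProd A f k hk.le (Pi.single (f ⟨k, hk⟩) 1) h := rfl

theorem prefixProd_succ (f : Fin ν → I) (n : ℕ) (hn : n + 1 ≤ ν) :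
    prefixProd A f (n + 1) hn = prefixProd A f n (by omega) * sE A (f ⟨n, hn⟩) := by
  simp only [prefixProd, List.ofFn_succ', List.concat_eq_append, List.prod_append,
    List.prod_singleton]
  rfl

theorem prefixProd_add (f : Fin ν → I) (n : ℕ) (hn : n ≤ ν) (x y : I → ℤ) :
    prefixProd A f n hn (x + y) = prefixProd A f n hn x + prefixProd A f n hn y := by
  induction n generalizing x y with
  | zero => rfl
  | succ n ih =>
    rw [prefixProd_succ]
    change prefixProd A f n _ (sE A _ (x + y)) =
      prefixProd A f n _ (sE A _ x) + prefixProd A f n _ (sE A _ y)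
    rw [sE_add, ih]

theorem prefixProd_congr {f g : Fin ν → I} {n : ℕ} (hn : n ≤ ν)
    (hfg : ∀ k : Fin ν, (k : ℕ) < n → g k = f k) :
    prefixProd A f n hn = prefixProd A g n hn := by
  unfold prefixProd
  congr 2
  funext m
  rw [hfg _ m.2]

theorem prefixProd_eq_of_le {f g : Fin ν → I} {m n : ℕ} (hmn : m ≤ n) (hn : n ≤ ν)
    (hm : prefixProd A f m (hmn.trans hn) = prefixProd A g m (hmn.trans hn))
    (hfg : ∀ k : Fin ν, m ≤ (k : ℕ) → g k = f k) :
    prefixProd A f n hn = prefixProd A g n hn := by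
  induction n, hmn using Nat.le_induction with
  | base => exact hm
  | succ n hmn ih => rw [prefixProd_succ, prefixProd_succ, ih (by omega) hm, hfg ⟨n, hn⟩ hmn]

end SimpleReflections

/-- behaviour of the coefficients `r_{h,k}` under a single braid
move relating two reduced words `f, g ∈ ℐ`. -/
theorem rCoef_braid_move (A : Matrix I I ℤ) (hA : IsSimplyLacedCartan A)
    (w₀ : Function.End (I → ℤ)) (ν : ℕ) (hw : IsLongest A w₀ ν)
    (f g : Fin ν → I) (hf : f ∈ RedWord A w₀ ν) (hg : g ∈ RedWord A w₀ ν) :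
    (∀ (l : ℕ) (h0 : l < ν) (h1 : l + 1 < ν) (h2 : l + 2 < ν),
      A (f ⟨l, h0⟩) (f ⟨l + 1, h1⟩) = -1 →
      f ⟨l + 2, h2⟩ = f ⟨l, h0⟩ →
      g ⟨l, h0⟩ = f ⟨l + 1, h1⟩ → g ⟨l + 1, h1⟩ = f ⟨l, h0⟩ →
      g ⟨l + 2, h2⟩ = f ⟨l + 1, h1⟩ →
      (∀ k : Fin ν, (k : ℕ) ≠ l → (k : ℕ) ≠ l + 1 → (k : ℕ) ≠ l + 2 → g k = f k) →
      ∀ h : I,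
        (∀ k : Fin ν, (k : ℕ) ≠ l → (k : ℕ) ≠ l + 1 → (k : ℕ) ≠ l + 2 →
          rCoef A f h k = rCoef A g h k) ∧
        rCoef A f h ⟨l, h0⟩ = rCoef A g h ⟨l + 2, h2⟩ ∧
        rCoef A f h ⟨l + 2, h2⟩ = rCoef A g h ⟨l, h0⟩ ∧
        rCoef A f h ⟨l + 1, h1⟩ = rCoef A g h ⟨l + 1, h1⟩ ∧
        rCoef A f h ⟨l + 1, h1⟩ = rCoef A f h ⟨l, h0⟩ + rCoef A f h ⟨l + 2, h2⟩) ∧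
    (∀ (l : ℕ) (h0 : l < ν) (h1 : l + 1 < ν),
      A (f ⟨l, h0⟩) (f ⟨l + 1, h1⟩) = 0 →
      g ⟨l, h0⟩ = f ⟨l + 1, h1⟩ → g ⟨l + 1, h1⟩ = f ⟨l, h0⟩ →
      (∀ k : Fin ν, (k : ℕ) ≠ l → (k : ℕ) ≠ l + 1 → g k = f k) →
      ∀ h : I,
        (∀ k : Fin ν, (k : ℕ) ≠ l → (k : ℕ) ≠ l + 1 →
          rCoef A f h k = rCoef A g h k) ∧
        rCoef A f h ⟨l, h0⟩ = rCoef A g h ⟨l + 1, h1⟩ ∧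
        rCoef A f h ⟨l + 1, h1⟩ = rCoef A g h ⟨l, h0⟩) := by
  constructor
  · intro l h0 h1 h2 hij hf2 hg0 hg1 hg2 hfg h
    have hl : prefixProd A f l h0.le = prefixProd A g l h0.le :=
      prefixProd_congr h0.le fun k hk => hfg k (by omega) (by omega) (by omega)
    have hji : A (f ⟨l + 1, h1⟩) (f ⟨l, h0⟩) = -1 := by rw [hA.symm, hij]
    have hl3 : prefixProd A f (l + 3) h2 = prefixProd A g (l + 3) h2 := by
      simp only [prefixProd_succ, hl, hf2, hg0, hg1, hg2, mul_assoc]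
      congr 1
      simpa only [mul_assoc] using sE_braid hA hij
    have hf1r : rCoef A f h ⟨l + 1, h1⟩ = prefixProd A g l h0.le
        (Pi.single (f ⟨l, h0⟩) 1 + Pi.single (f ⟨l + 1, h1⟩) 1) h := by
      rw [rCoef_eq, prefixProd_succ, hl]
      change prefixProd A g l _ (sE A _ _) h = _
      rw [sE_single, hij, neg_one_smul, sub_neg_eq_add, add_comm]
    have hg1r : rCoef A g h ⟨l + 1, h1⟩ = prefixProd A g l h0.le
        (Pi.single (f ⟨l, h0⟩) 1 + Pi.single (f ⟨l + 1, h1⟩) 1) h := by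
      rw [rCoef_eq, prefixProd_succ, hg0, hg1]
      change prefixProd A g l _ (sE A _ _) h = _
      rw [sE_single, hji, neg_one_smul, sub_neg_eq_add]
    have hf0r : rCoef A f h ⟨l, h0⟩ = prefixProd A g l h0.le (Pi.single (f ⟨l, h0⟩) 1) h := by
      rw [rCoef_eq, hl]
    have hf2r : rCoef A f h ⟨l + 2, h2⟩ =
        prefixProd A g l h0.le (Pi.single (f ⟨l + 1, h1⟩) 1) h := by
      rw [rCoef_eq, prefixProd_succ, prefixProd_succ, hl, hf2]
      change prefixProd A g l _ (sE A _ (sE A _ _)) h = _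
      rw [sE_sE_single_of_eq_neg_one hA hij]
    refine ⟨?_, ?_, ?_, hf1r.trans hg1r.symm, ?_⟩
    · rintro ⟨k, hk⟩ hk0 hk1 hk2
      simp only at hk0 hk1 hk2
      rw [rCoef_eq, rCoef_eq, hfg ⟨k, hk⟩ hk0 hk1 hk2]
      rcases lt_or_gt_of_ne hk0 with hlt | hgt
      · rw [prefixProd_congr hk.le fun m hm => hfg m (by omega) (by omega) (by omega)]
      · rw [prefixProd_eq_of_le (by omega : l + 3 ≤ k) hk.le hl3
          fun m hm => hfg m (by omega) (by omega) (by omega)]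
    · rw [hf0r, rCoef_eq, prefixProd_succ, prefixProd_succ, hg0, hg1, hg2]
      change _ = prefixProd A g l _ (sE A _ (sE A _ _)) h
      rw [sE_sE_single_of_eq_neg_one hA hji]
    · rw [hf2r, rCoef_eq, hg0]
    · rw [hf1r, hf0r, hf2r, prefixProd_add, Pi.add_apply]
  · intro l h0 h1 hij hg0 hg1 hfg h
    have hl : prefixProd A f l h0.le = prefixProd A g l h0.le :=
      prefixProd_congr h0.le fun k hk => hfg k (by omega) (by omega)
    have hji : A (f ⟨l + 1, h1⟩) (f ⟨l, h0⟩) = 0 := by rw [hA.symm, hij]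
    have hl2 : prefixProd A f (l + 2) h1 = prefixProd A g (l + 2) h1 := by
      simp only [prefixProd_succ, hl, hg0, hg1, mul_assoc]
      rw [sE_comm hA hij]
    refine ⟨?_, ?_, ?_⟩
    · rintro ⟨k, hk⟩ hk0 hk1
      simp only at hk0 hk1
      rw [rCoef_eq, rCoef_eq, hfg ⟨k, hk⟩ hk0 hk1]
      rcases lt_or_gt_of_ne hk0 with hlt | hgt
      · rw [prefixProd_congr hk.le fun m hm => hfg m (by omega) (by omega)]
      · rw [prefixProd_eq_of_le (by omega : l + 2 ≤ k) hk.le hl2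
          fun m hm => hfg m (by omega) (by omega)]
    · rw [rCoef_eq, rCoef_eq, prefixProd_succ, hg0, hg1, hl]
      change _ = prefixProd A g l _ (sE A _ _) h
      rw [sE_single, hji, zero_smul, sub_zero]
    · rw [rCoef_eq, rCoef_eq, prefixProd_succ, hg0, hl]
      change prefixProd A g l _ (sE A _ _) h = _
      rw [sE_single, hij, zero_smul, sub_zero]

end Lusztig
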